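/- The set quotient of lists by the relation R is the free commutative monoid: for any type A, the map List A → Multiset A (sending a list to its multiset of elements) descends to a well-defined bijection from the quotient Quot R to Multiset A, which sends the class of the empty list to the empty multiset and the class of a concatenation as ++ bs to the multiset sum of the classes of as and bs. Hence Quot R, with the operation induced by concatenation, is an additive commutative monoid isomorphic to Multiset A. -/

import Mathlib

/-- The commutation deduction system for multiset equality. -/
inductive R {A : Type*} : List A → List A → Prop
  | nil : R [] []
  | cons_cong {a b : A} {as bs : List A} : a = b → R as bs → R (a :: as) (b :: bs)
  | comm {a b : A} {as bs cs : List A} :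
      R as (b :: cs) → R (a :: cs) bs → R (a :: as) (b :: bs)

theorem R.perm {A : Type*} {as bs : List A} (h : R as bs) : as.Perm bs := by
  induction h with
  | nil => exact .nil
  | cons_cong h _ ih => exact h ▸ ih.cons _
  | @comm a b as bs cs _ _ ih₁ ih₂ =>
    exact (ih₁.cons a).trans ((List.Perm.swap b a cs).trans (ih₂.cons b))

theorem R.of_perm {A : Type*} : ∀ {as bs : List A}, as.Perm bs → R as bs
  | [], bs, h => by
    rw [h.nil_eq.symm]
    exact .nil
  | a :: as, [], h => by simp at h
  | a :: as, b :: bs, h => by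
    classical
    by_cases hab : a = b
    · subst hab
      exact .cons_cong rfl (R.of_perm h.cons_inv)
    · have hb : b ∈ as := by
        have := h.mem_iff.mpr (List.mem_cons_self (a := b) (l := bs))
        simpa [Ne.symm hab] using this
      have h₁ : as.Perm (b :: as.erase b) := List.perm_cons_erase hb
      have h₂ : (a :: as.erase b).Perm bs :=
        ((List.Perm.swap a b _).trans ((h₁.symm.cons a).trans h)).cons_inv
      have hlen : (a :: as.erase b).length = as.length := by simpa using h₁.length_eq.symm
      exact .comm (R.of_perm h₁) (R.of_perm h₂)
termination_by as => as.length
decreasing_by all_goals simp only [List.length_cons] at *; omega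

/-- The set quotient of lists by `R` is the free commutative monoid: the map
sending a list to its multiset of elements descends to a bijection
`Quot R ≃ Multiset A` which is moreover a monoid isomorphism from the structure
induced by concatenation. -/
theorem quot_R_equiv_multiset (A : Type*) :
    ∃ F : Quot (R (A := A)) → Multiset A,
      (∀ as : List A, F (Quot.mk R as) = (as : Multiset A)) ∧
      Function.Bijective F ∧
      F (Quot.mk R ([] : List A)) = 0 ∧
      ∀ as bs : List A,
        F (Quot.mk R (as ++ bs)) = F (Quot.mk R as) + F (Quot.mk R bs) := by
  refine ⟨Quot.lift (fun as => (as : Multiset A)) fun _ _ h => Multiset.coe_eq_coe.mpr h.perm,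
    fun _ => rfl, ⟨?_, ?_⟩, rfl, fun _ _ => rfl⟩
  · rintro ⟨as⟩ ⟨bs⟩ h
    exact Quot.sound (.of_perm (Multiset.coe_eq_coe.mp h))
  · rintro ⟨as⟩
    exact ⟨Quot.mk R as, rfl⟩
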